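/- arXiv:1711.00428 — 2 statements merged into one kernel-verified Lean document; each statement's English description precedes it below -/
import Mathlib

section
/- Let Q be a WQO such that o(Q) is a multiplicative principal ordinal and h(Q) < o(Q). Then w(Q) = o(Q). -/
universe u

open Ordinal

/-- The rank of a well-founded relation: the least ordinal `γ` admitting a
strictly `r`-decreasing... i.e. `r a b → f a < f b`; equals `sup (rank a + 1)`. -/
noncomputable def relRank {β : Type u} (r : β → β → Prop) : Ordinal.{u} :=
  haveI := Classical.propDecidable (WellFounded r)
  if h : WellFounded r then ⨆ a : β, Order.succ ((h.apply a).rank) else 0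

/-- `extRel T s t` : `s` strictly extends `t` (both in tree `T`). -/
def extRel {α : Type u} (T : Set (List α)) (s t : T) : Prop :=
  t.1 <+: s.1 ∧ t.1 ≠ s.1

/-- Rank of a tree of finite sequences ordered by the initial segment relation. -/
noncomputable def treeRank {α : Type u} (T : Set (List α)) : Ordinal.{u} :=
  relRank (extRel T)

/-- Non-empty finite sequences of pairwise incomparable elements. -/
def IncSeqs (P : Type u) [Preorder P] : Set (List P) :=
  {l | l ≠ [] ∧ l.Pairwise fun x y => ¬ x ≤ y ∧ ¬ y ≤ x}

/-- Non-empty strictly descending finite sequences. -/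
def DecSeqs (P : Type u) [Preorder P] : Set (List P) :=
  {l | l ≠ [] ∧ l.Pairwise fun x y => y < x}

/-- Non-empty bad sequences. -/
def BadSeqs (P : Type u) [Preorder P] : Set (List P) :=
  {l | l ≠ [] ∧ l.Pairwise fun x y => ¬ x ≤ y}

/-- Width of a FAC (quasi-)order: the rank of its tree of antichain sequences. -/
noncomputable def width (P : Type u) [Preorder P] : Ordinal.{u} := treeRank (IncSeqs P)

/-- Height: the rank of the tree of strictly descending sequences. -/
noncomputable def height (P : Type u) [Preorder P] : Ordinal.{u} := treeRank (DecSeqs P)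

/-- Maximal order type: the rank of the tree of bad sequences. -/
noncomputable def mot (P : Type u) [Preorder P] : Ordinal.{u} := treeRank (BadSeqs P)

/-- Finite antichain condition. -/
def FAC (P : Type u) [Preorder P] : Prop :=
  ∀ A : Set P, IsAntichain (· ≤ ·) A → A.Finite

/-- Well quasi-order: every infinite sequence is good. -/
def IsWQO (P : Type u) [Preorder P] : Prop :=
  ∀ f : ℕ → P, ∃ i j : ℕ, i < j ∧ f i ≤ f j

/-- Well partial order. -/
def IsWPO (P : Type u) [Preorder P] : Prop :=
  WellFounded ((· < ·) : P → P → Prop) ∧ FAC P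


namespace Stmt12

open Order Set

/-! ### Natural sum -/

/-- Natural (Hessenberg) sum. -/
noncomputable def nsum (a b : Ordinal.{u}) : Ordinal.{u} :=
  max (⨆ x : Iio a, succ (nsum x.1 b)) (⨆ x : Iio b, succ (nsum a x.1))
termination_by (a, b)
decreasing_by
  · exact Prod.Lex.left _ _ x.2
  · exact Prod.Lex.right _ x.2

theorem nsum_lt_left {a a' : Ordinal.{u}} (b : Ordinal.{u}) (h : a' < a) :
    nsum a' b < nsum a b := by
  rw [nsum.eq_1 a b, ← succ_le_iff]
  exact le_max_of_le_left
    (le_ciSup (f := fun x : Iio a => succ (nsum x.1 b)) (bddAbove_of_small) ⟨a', h⟩)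

theorem nsum_lt_right {b b' : Ordinal.{u}} (a : Ordinal.{u}) (h : b' < b) :
    nsum a b' < nsum a b := by
  rw [nsum.eq_1 a b, ← succ_le_iff]
  exact le_max_of_le_right
    (le_ciSup (f := fun x : Iio b => succ (nsum a x.1)) (bddAbove_of_small) ⟨b', h⟩)

theorem nsum_le {a b c : Ordinal.{u}} (h1 : ∀ a' < a, nsum a' b < c)
    (h2 : ∀ b' < b, nsum a b' < c) : nsum a b ≤ c := by
  rw [nsum.eq_1 a b]
  apply max_le
  · exact ciSup_le' fun x => succ_le_of_lt (h1 _ x.2)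
  · exact ciSup_le' fun x => succ_le_of_lt (h2 _ x.2)

theorem exists_decomp {W a : Ordinal.{u}} (N : ℕ) (h : a < W * N) :
    ∃ i : ℕ, i < N ∧ ∃ x < W, a = W * i + x := by
  have hW : W ≠ 0 := by rintro rfl; simp at h
  have h1 : a / W < N := (Ordinal.div_lt hW).2 h
  obtain ⟨i, hi⟩ := Ordinal.lt_omega0.1 (h1.trans (Ordinal.natCast_lt_omega0 N))
  refine ⟨i, ?_, a % W, Ordinal.mod_lt a hW, ?_⟩
  · rw [hi] at h1; exact_mod_cast h1
  · rw [← hi]; exact (Ordinal.div_add_mod a W).symm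

theorem exists_decomp_lt {W a x : Ordinal.{u}} (n : ℕ) (hx : x < W) (h : a < W * n + x) :
    ∃ i : ℕ, ∃ x' < W, a = W * i + x' ∧ (i < n ∨ (i = n ∧ x' < x)) := by
  by_cases h1 : a < W * n
  · obtain ⟨i, hi, x', hx', e⟩ := exists_decomp n h1
    exact ⟨i, x', hx', e, Or.inl hi⟩
  · have h1 := not_lt.1 h1
    have e := Ordinal.add_sub_cancel_of_le h1
    have : a - W * n < x := by
      rw [← e] at h; exact lt_of_add_lt_add_left h
    exact ⟨n, a - W * n, this.trans hx, e.symm, Or.inr ⟨rfl, this⟩⟩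

theorem mul_nat_add_lt {W z t : Ordinal.{u}} {k l : ℕ} (hz : z < W) (hkl : k < l) :
    W * k + z < W * l + t := by
  calc W * k + z < W * k + W := by gcongr
    _ = W * ((k + 1 : ℕ) : Ordinal.{u}) := by rw [Nat.cast_succ, mul_add, mul_one]
    _ ≤ W * l := by gcongr; exact hkl
    _ ≤ W * l + t := by simp

theorem nsum_block (W : Ordinal.{u}) (hW : ∀ x < W, ∀ y < W, nsum x y < W) :
    ∀ a b : Ordinal.{u}, ∀ n m : ℕ, ∀ x < W, ∀ y < W, a = W * n + x → b = W * m + y →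
      nsum a b ≤ W * ((n + m : ℕ) : Ordinal.{u}) + nsum x y := by
  intro a
  induction a using WellFoundedLT.induction with
  | ind a iha =>
  intro b
  induction b using WellFoundedLT.induction with
  | ind b ihb =>
  intro n m x hx y hy ea eb
  apply nsum_le
  · intro a' ha'
    obtain ⟨i, x', hx', e, hi⟩ := exists_decomp_lt n hx (ea ▸ ha')
    refine (iha a' ha' b i m x' hx' y hy e eb).trans_lt ?_
    rcases hi with hi | ⟨rfl, hlt⟩
    · exact mul_nat_add_lt (hW _ hx' _ hy) (by omega)
    · have := nsum_lt_left y hlt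
      gcongr
  · intro b' hb'
    obtain ⟨i, y', hy', e, hi⟩ := exists_decomp_lt m hy (eb ▸ hb')
    refine (ihb b' hb' n i x hx y' hy' ea e).trans_lt ?_
    rcases hi with hi | ⟨rfl, hlt⟩
    · exact mul_nat_add_lt (hW _ hx _ hy') (by omega)
    · have := nsum_lt_right x hlt
      gcongr

theorem nsum_lt_opow (r : Ordinal.{u}) : ∀ x < ω ^ r, ∀ y < ω ^ r, nsum x y < ω ^ r := by
  induction r using WellFoundedLT.induction with
  | ind r ih =>
  intro x hx y hy
  by_cases hr : r = 0
  · subst hr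
    have hx0 : x = 0 := by simpa using hx
    have hy0 : y = 0 := by simpa using hy
    subst hx0 hy0
    refine (nsum_le (c := 0) ?_ ?_).trans_lt (by simp) <;> simp
  · obtain ⟨c, hc, n, hn⟩ := (lt_omega0_opow hr).1 hx
    obtain ⟨d, hd, m, hm⟩ := (lt_omega0_opow hr).1 hy
    have he : max c d < r := max_lt hc hd
    have hcl := ih _ he
    have hn' : x < ω ^ (max c d) * n := hn.trans_le (by
      gcongr; · exact omega0_pos
      · exact le_max_left _ _)
    have hm' : y < ω ^ (max c d) * m := hm.trans_le (by
      gcongr; · exact omega0_pos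
      · exact le_max_right _ _)
    obtain ⟨i, -, x', hx', ex⟩ := exists_decomp n hn'
    obtain ⟨j, -, y', hy', ey⟩ := exists_decomp m hm'
    refine (nsum_block _ hcl x y i j x' hx' y' hy' ex ey).trans_lt ?_
    refine (mul_nat_add_lt (t := 0) (hcl _ hx' _ hy') (Nat.lt_succ_self _)).trans ?_
    rw [add_zero]
    exact opow_mul_lt_opow (natCast_lt_omega0 _) he

/-! ### Bounds on the rank of the tree of bad sequences in a subset -/

/-- `Bd S c`: the tree of bad sequences in `S` has rank at most `c`. -/
inductive Bd {P : Type*} [Preorder P] : Set P → Ordinal.{u} → Prop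
  | mk (S : Set P) (c : Ordinal.{u}) (f : P → Ordinal.{u}) (hf : ∀ x ∈ S, f x < c)
      (h : ∀ x ∈ S, Bd (S ∩ {y | ¬ x ≤ y}) (f x)) : Bd S c

section
variable {P : Type*} [Preorder P]

theorem Bd.exists_lt {S : Set P} {c : Ordinal.{u}} (h : Bd S c) {x : P} (hx : x ∈ S) :
    ∃ d < c, Bd (S ∩ {y | ¬ x ≤ y}) d := by
  cases h with
  | mk _ _ f hf h => exact ⟨f x, hf x hx, h x hx⟩

theorem Bd.of_exists {S : Set P} {c : Ordinal.{u}}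
    (h : ∀ x ∈ S, ∃ d < c, Bd (S ∩ {y | ¬ x ≤ y}) d) : Bd S c := by
  classical
  refine Bd.mk S c (fun x => if hx : x ∈ S then (h x hx).choose else 0) ?_ ?_
  · intro x hx
    simp only [hx, dite_true]
    exact (h x hx).choose_spec.1
  · intro x hx
    simp only [hx, dite_true]
    exact (h x hx).choose_spec.2

theorem Bd.mono_right {S : Set P} {c d : Ordinal.{u}} (h : Bd S c) (hcd : c ≤ d) : Bd S d :=
  Bd.of_exists fun _ hx => by
    obtain ⟨e, he, hb⟩ := h.exists_lt hx
    exact ⟨e, he.trans_le hcd, hb⟩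

theorem Bd.comap {R : Type*} [Preorder R] {T : Set R} {c : Ordinal.{u}} (h : Bd T c) :
    ∀ {S : Set P} (f : P → R), (∀ x ∈ S, f x ∈ T) →
      (∀ x ∈ S, ∀ y ∈ S, f x ≤ f y → x ≤ y) → Bd S c := by
  induction h with
  | mk T c g hg _ ih =>
  intro S f hf hr
  refine Bd.of_exists fun x hx => ⟨g (f x), hg _ (hf x hx), ih (f x) (hf x hx) f ?_ ?_⟩
  · rintro y ⟨hy, hxy⟩
    exact ⟨hf y hy, fun hle => hxy (hr x hx y hy hle)⟩
  · rintro y ⟨hy, -⟩ z ⟨hz, -⟩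
    exact hr y hy z hz

theorem Bd.mono_left {S T : Set P} {c : Ordinal.{u}} (h : Bd T c) (hST : S ⊆ T) : Bd S c :=
  h.comap id (fun _ hx => hST hx) (fun _ _ _ _ h => h)

theorem Bd.union {a b : Ordinal.{u}} : ∀ {S T : Set P}, Bd S a → Bd T b →
    Bd (S ∪ T) (nsum a b) := by
  induction a using WellFoundedLT.induction generalizing b with
  | ind a iha =>
  induction b using WellFoundedLT.induction with
  | ind b ihb =>
  intro S T hS hT
  refine Bd.of_exists ?_
  rintro x (hx | hx)
  · obtain ⟨d, hd, hb⟩ := hS.exists_lt hx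
    refine ⟨nsum d b, nsum_lt_left _ hd, (iha d hd hb hT).mono_left ?_⟩
    rintro y ⟨hy | hy, hxy⟩
    · exact Or.inl ⟨hy, hxy⟩
    · exact Or.inr hy
  · obtain ⟨d, hd, hb⟩ := hT.exists_lt hx
    refine ⟨nsum a d, nsum_lt_right _ hd, (ihb d hd hS hb).mono_left ?_⟩
    rintro y ⟨hy | hy, hxy⟩
    · exact Or.inl hy
    · exact Or.inr ⟨hy, hxy⟩

end

/-- The rectangle `a × b`. -/
def rect (a b : Ordinal.{u}) : Set (Ordinal.{u} × Ordinal.{u}) := {p | p.1 < a ∧ p.2 < b}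

theorem Bd.swap {a b c : Ordinal.{u}} (h : Bd (rect a b) c) : Bd (rect b a) c := by
  refine h.comap Prod.swap (fun x hx => ⟨hx.2, hx.1⟩) ?_
  intro x _ y _ hxy
  exact ⟨hxy.2, hxy.1⟩

theorem Bd.mul_left {a b c r : Ordinal.{u}} (h : Bd (rect a b) c) (hc : c < ω ^ r) (n : ℕ) :
    ∃ d < ω ^ r, Bd (rect (a * n) b) d := by
  induction n with
  | zero =>
    refine ⟨0, opow_pos _ omega0_pos, Bd.of_exists ?_⟩
    rintro x ⟨hx, -⟩
    simp at hx
  | succ n ih =>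
    obtain ⟨d, hd, hb⟩ := ih
    have h2 : Bd {p : Ordinal.{u} × Ordinal.{u} | a * n ≤ p.1 ∧ p.1 < a * n + a ∧ p.2 < b} c := by
      refine h.comap (fun p => (p.1 - a * n, p.2)) ?_ ?_
      · rintro p ⟨h1, h2, h3⟩
        refine ⟨?_, h3⟩
        rw [← Ordinal.add_sub_cancel_of_le h1] at h2
        exact lt_of_add_lt_add_left h2
      · rintro p ⟨h1, -, -⟩ q ⟨h2, -, -⟩ ⟨hle, hle2⟩
        refine ⟨?_, hle2⟩
        rw [← Ordinal.add_sub_cancel_of_le h1, ← Ordinal.add_sub_cancel_of_le h2]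
        exact add_le_add_right hle _
    refine ⟨nsum d c, nsum_lt_opow r _ hd _ hc, (hb.union h2).mono_left ?_⟩
    rintro p ⟨h1, h3⟩
    by_cases h4 : p.1 < a * n
    · exact Or.inl ⟨h4, h3⟩
    · refine Or.inr ⟨not_lt.1 h4, ?_, h3⟩
      rwa [Nat.cast_succ, mul_add, mul_one] at h1

theorem rect_mono {a a' b b' : Ordinal.{u}} (ha : a ≤ a') (hb : b ≤ b') :
    rect a b ⊆ rect a' b' := fun _ h => ⟨h.1.trans_le ha, h.2.trans_le hb⟩

theorem bd_opow (p : Ordinal.{u}) : ∀ q : Ordinal.{u},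
    Bd (rect (ω ^ p) (ω ^ q)) (ω ^ nsum p q) := by
  induction p using WellFoundedLT.induction with
  | ind p ihp =>
  intro q
  induction q using WellFoundedLT.induction with
  | ind q ihq =>
  have left : ∀ x < ω ^ p, ∃ d < ω ^ nsum p q, Bd (rect x (ω ^ q)) d := by
    intro x hx
    by_cases hp : p = 0
    · subst hp
      have hx0 : x = 0 := by simpa using hx
      subst hx0
      exact ⟨0, opow_pos _ omega0_pos, Bd.of_exists fun y hy => absurd hy.1 (by simp)⟩
    · obtain ⟨c, hc, n, hn⟩ := (lt_omega0_opow hp).1 hx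
      obtain ⟨d, hd, hb⟩ := (ihp c hc q).mul_left
        ((opow_lt_opow_iff_right one_lt_omega0).2 (nsum_lt_left q hc)) n
      exact ⟨d, hd, hb.mono_left (rect_mono hn.le le_rfl)⟩
  have right : ∀ x < ω ^ q, ∃ d < ω ^ nsum p q, Bd (rect (ω ^ p) x) d := by
    intro x hx
    by_cases hq : q = 0
    · subst hq
      have hx0 : x = 0 := by simpa using hx
      subst hx0
      exact ⟨0, opow_pos _ omega0_pos, Bd.of_exists fun y hy => absurd hy.2 (by simp)⟩
    · obtain ⟨c, hc, n, hn⟩ := (lt_omega0_opow hq).1 hx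
      obtain ⟨d, hd, hb⟩ := (ihq c hc).swap.mul_left
        ((opow_lt_opow_iff_right one_lt_omega0).2 (nsum_lt_right p hc)) n
      exact ⟨d, hd, hb.swap.mono_left (rect_mono le_rfl hn.le)⟩
  refine Bd.of_exists ?_
  rintro ⟨x, y⟩ ⟨hx, hy⟩
  obtain ⟨d, hd, hbd⟩ := left x hx
  obtain ⟨e, he, hbe⟩ := right y hy
  refine ⟨nsum d e, nsum_lt_opow _ _ hd _ he, (hbd.union hbe).mono_left ?_⟩
  rintro ⟨u, v⟩ ⟨⟨hu, hv⟩, hn⟩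
  by_cases h1 : u < x
  · exact Or.inl ⟨h1, hv⟩
  · by_cases h2 : v < y
    · exact Or.inr ⟨hu, h2⟩
    · exact absurd (⟨not_lt.1 h1, not_lt.1 h2⟩ : (x, y) ≤ (u, v)) hn

theorem bd_of_lt {a b r : Ordinal.{u}} (ha : a < ω ^ ω ^ r) (hb : b < ω ^ ω ^ r) :
    ∃ d < ω ^ ω ^ r, Bd (rect a b) d := by
  have hr : (ω : Ordinal.{u}) ^ r ≠ 0 := (opow_pos _ omega0_pos).ne'
  obtain ⟨p, hp, n, hn⟩ := (lt_omega0_opow hr).1 ha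
  obtain ⟨q, hq, m, hm⟩ := (lt_omega0_opow hr).1 hb
  obtain ⟨d, hd, hbd⟩ := (bd_opow p q).mul_left
    ((opow_lt_opow_iff_right one_lt_omega0).2 (nsum_lt_opow r p hp q hq)) n
  obtain ⟨e, he, hbe⟩ := hbd.swap.mul_left hd m
  exact ⟨e, he, hbe.swap.mono_left (rect_mono hn.le hm.le)⟩

/-! ### Ranks of trees -/

theorem relRank_le {β : Type u} (r : β → β → Prop)
    (c : Ordinal.{u}) (g : β → Ordinal.{u}) (hg : ∀ a, g a < c)
    (hr : ∀ a b, r a b → g a < g b) : relRank r ≤ c := by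
  unfold relRank
  split_ifs with h
  · refine ciSup_le' fun a => succ_le_of_lt (lt_of_le_of_lt ?_ (hg a))
    induction a using h.induction with
    | h a ih =>
    rw [Acc.rank_eq]
    refine ciSup_le' fun b => succ_le_of_lt (lt_of_le_of_lt (ih b.1 b.2) (hr _ _ b.2))
  · exact zero_le

theorem exists_rank {β : Type u} (r : β → β → Prop) (h : WellFounded r) :
    ∃ g : β → Ordinal.{u}, (∀ a, g a < relRank r) ∧ ∀ a b, r a b → g a < g b := by
  refine ⟨fun a => (h.apply a).rank, ?_, ?_⟩
  · intro a
    unfold relRank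
    rw [dif_pos h, ← succ_le_iff]
    exact le_ciSup (f := fun a => succ ((h.apply a).rank)) (bddAbove_of_small) a
  · intro a b hab
    exact Acc.rank_lt_of_rel (h.apply b) hab

theorem exists_tree_rank {α : Type u} (T : Set (List α)) (h : WellFounded (extRel T)) :
    ∃ F : List α → Ordinal.{u}, (∀ l ∈ T, F l < treeRank T) ∧
      ∀ s ∈ T, ∀ t ∈ T, t <+: s → t ≠ s → F s < F t := by
  classical
  obtain ⟨g, h1, h2⟩ := exists_rank _ h
  refine ⟨fun l => if hl : l ∈ T then g ⟨l, hl⟩ else 0, ?_, ?_⟩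
  · intro l hl
    simp only [hl, dite_true]
    exact h1 _
  · intro s hs t ht hp hne
    simp only [hs, ht, dite_true]
    exact h2 _ _ ⟨hp, hne⟩

theorem wf_subset {α : Type u} {T T' : Set (List α)} (h : WellFounded (extRel T))
    (hs : T' ⊆ T) : WellFounded (extRel T') :=
  Subrelation.wf (r := InvImage (extRel T) (fun s : T' => ⟨s.1, hs s.2⟩))
    (fun hab => hab) (InvImage.wf _ h)

theorem treeRank_mono {α : Type u} {T T' : Set (List α)} (h : WellFounded (extRel T))
    (hs : T' ⊆ T) : treeRank T' ≤ treeRank T := by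
  obtain ⟨g, h1, h2⟩ := exists_rank _ h
  exact relRank_le _ _ (fun s => g ⟨s.1, hs s.2⟩) (fun s => h1 _) (fun a b hab => h2 _ _ hab)

theorem wf_of_ne_zero {α : Type u} {T : Set (List α)} (h : treeRank T ≠ 0) :
    WellFounded (extRel T) := by
  by_contra hn
  exact h (by unfold treeRank relRank; rw [dif_neg hn])

section
variable {Q : Type u} [Preorder Q]

theorem inc_subset : IncSeqs Q ⊆ BadSeqs Q := fun _ h => ⟨h.1, h.2.imp fun h => h.1⟩

theorem dec_subset : DecSeqs Q ⊆ BadSeqs Q :=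
  fun _ h => ⟨h.1, h.2.imp fun h => not_le_of_gt h⟩

/-- Height rank function. -/
theorem exists_height_rank (h : WellFounded (extRel (DecSeqs Q))) :
    ∃ ρ : Q → Ordinal.{u}, (∀ x, ρ x < height Q) ∧ ∀ x y, y < x → ρ y < ρ x := by
  obtain ⟨F, h1, h2⟩ := exists_tree_rank _ h
  let A : Q → Set Ordinal.{u} := fun x => {o | ∃ l, l ++ [x] ∈ DecSeqs Q ∧ o = F (l ++ [x])}
  have hA : ∀ x, (A x).Nonempty := fun x => ⟨_, [], ⟨by simp, by simp⟩, rfl⟩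
  refine ⟨fun x => sInf (A x), ?_, ?_⟩
  · intro x
    obtain ⟨l, hl, e⟩ := csInf_mem (hA x)
    simp only [e]
    exact h1 _ hl
  · intro x y hyx
    obtain ⟨l, hl, e⟩ := csInf_mem (hA x)
    simp only [e]
    have hm : (l ++ [x]) ++ [y] ∈ DecSeqs Q := by
      refine ⟨by simp, ?_⟩
      rw [List.pairwise_append]
      refine ⟨hl.2, by simp, ?_⟩
      intro a ha b hb
      obtain rfl : b = y := by simpa using hb
      rcases List.mem_append.1 ha with ha | ha
      · exact hyx.trans ((List.pairwise_append.1 hl.2).2.2 a ha x (by simp))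
      · obtain rfl : a = x := by simpa using ha
        exact hyx
    exact (csInf_le' (show F (l ++ [x] ++ [y]) ∈ A y from ⟨l ++ [x], hm, rfl⟩)).trans_lt
      (h2 _ hm _ hl (List.prefix_append _ _) (by simp))

theorem mot_le (hwf : WellFounded (extRel (BadSeqs Q))) {c : Ordinal.{u}}
    (hc : Bd (rect (height Q) (width Q)) c) : mot Q ≤ c := by
  obtain ⟨ρ, hρ1, hρ2⟩ := exists_height_rank (wf_subset hwf (dec_subset (Q := Q)))
  obtain ⟨F, hF1, hF2⟩ := exists_tree_rank _ (wf_subset hwf (inc_subset (Q := Q)))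
  -- points attached to a sequence
  let A : List Q → Set (Ordinal.{u} × Ordinal.{u}) := fun s =>
    {z | ∃ l x, (l ++ [x]).Sublist s ∧ (l ++ [x]).Pairwise (fun a b => ρ a ≤ ρ b) ∧
      z = (ρ x, F (l ++ [x]))}
  let R : List Q → Set (Ordinal.{u} × Ordinal.{u}) := fun s =>
    {y | y ∈ rect (height Q) (width Q) ∧ ∀ z ∈ A s, ¬ z ≤ y}
  let rk : Set (Ordinal.{u} × Ordinal.{u}) → Ordinal.{u} := fun S => sInf {c | Bd S c}
  have hAmono : ∀ s t : List Q, t.Sublist s → A t ⊆ A s := by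
    rintro s t hts z ⟨l, x, h1, h2, h3⟩
    exact ⟨l, x, h1.trans hts, h2, h3⟩
  have hR : ∀ s, Bd (R s) c := fun s => hc.mono_left fun y hy => hy.1
  have hinc : ∀ s : List Q, s.Pairwise (fun x y => ¬ x ≤ y) → ∀ l x, (l ++ [x]).Sublist s →
      (l ++ [x]).Pairwise (fun a b => ρ a ≤ ρ b) → l ++ [x] ∈ IncSeqs Q := by
    intro s hs l x h1 h2
    refine ⟨by simp, ((hs.sublist h1).and h2).imp ?_⟩
    rintro a b ⟨hab, hr⟩
    exact ⟨hab, fun hba => absurd (hρ2 a b (lt_of_le_not_ge hba hab)) (not_lt.2 hr)⟩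
  have key : ∀ (t : List Q) (x : Q), (t ++ [x]).Pairwise (fun x y => ¬ x ≤ y) →
      ∃ z ∈ A (t ++ [x]), z ∈ R t := by
    intro t x hb
    let B : Set Ordinal.{u} := {o | ∃ l, (l ++ [x]).Sublist (t ++ [x]) ∧
      (l ++ [x]).Pairwise (fun a b => ρ a ≤ ρ b) ∧ o = F (l ++ [x])}
    have hB : B.Nonempty := ⟨_, [], by simp, by simp, rfl⟩
    obtain ⟨l, h1, h2, h3⟩ := csInf_mem hB
    refine ⟨(ρ x, F (l ++ [x])), ⟨l, x, h1, h2, rfl⟩, ⟨hρ1 x, hF1 _ (hinc _ hb l x h1 h2)⟩, ?_⟩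
    rintro _ ⟨v, y, hv1, hv2, rfl⟩ ⟨hle1, hle2⟩
    have hle1 : ρ y ≤ ρ x := hle1
    have hle2 : F (v ++ [y]) ≤ F (l ++ [x]) := hle2
    have hsub : ((v ++ [y]) ++ [x]).Sublist (t ++ [x]) := hv1.append (List.Sublist.refl _)
    have hpw : ((v ++ [y]) ++ [x]).Pairwise (fun a b => ρ a ≤ ρ b) := by
      rw [List.pairwise_append]
      refine ⟨hv2, by simp, ?_⟩
      intro a ha b hb
      obtain rfl : b = x := by simpa using hb
      rcases List.mem_append.1 ha with ha | ha
      · exact ((List.pairwise_append.1 hv2).2.2 a ha y (by simp)).trans hle1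
      · obtain rfl : a = y := by simpa using ha
        exact hle1
    have hlt : F ((v ++ [y]) ++ [x]) < F (v ++ [y]) :=
      hF2 _ (hinc _ hb _ x hsub hpw) _ (hinc _ hb v y (hv1.trans (List.sublist_append_left _ _)) hv2)
        (List.prefix_append _ _) (by simp)
    have hmin : F (l ++ [x]) ≤ F ((v ++ [y]) ++ [x]) := by
      rw [← h3]
      exact csInf_le' ⟨v ++ [y], hsub, hpw, rfl⟩
    exact absurd (hle2.trans hmin) (not_le.2 hlt)
  have step : ∀ s t : List Q, s.Pairwise (fun x y => ¬ x ≤ y) → t <+: s → t ≠ s →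
      rk (R s) < rk (R t) := by
    rintro s t hs ⟨u, rfl⟩ hne
    cases u with
    | nil => simp at hne
    | cons x u =>
      have hsub : (t ++ [x]).Sublist (t ++ x :: u) := by
        refine List.Sublist.append (List.Sublist.refl _) ?_
        simp
      obtain ⟨z, hz1, hz2⟩ := key t x (hs.sublist hsub)
      have hm : Bd (R t) (rk (R t)) := csInf_mem (s := {c | Bd (R t) c}) ⟨c, hR t⟩
      obtain ⟨d, hd, hbd⟩ := hm.exists_lt hz2
      refine lt_of_le_of_lt (csInf_le' ?_) hd
      refine hbd.mono_left ?_
      rintro y ⟨hy1, hy2⟩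
      exact ⟨⟨hy1, fun w hw => hy2 w (hAmono _ _ (List.sublist_append_left _ _) hw)⟩,
        hy2 z (hAmono _ _ hsub hz1)⟩
  refine relRank_le _ _ (fun s => rk (R s.1)) ?_ ?_
  · rintro ⟨s, hs⟩
    exact (step s [] hs.2 List.nil_prefix hs.1.symm).trans_le (csInf_le' (hR []))
  · rintro ⟨s, hs⟩ ⟨t, ht⟩ ⟨hp, hne⟩
    exact step s t hs.2 hp hne

end

end Stmt12

/-- If `o(Q)` is multiplicative principal and `h(Q) < o(Q)`,
then `w(Q) = o(Q)`. -/
theorem stmt_12 {Q : Type u} [Preorder Q] (h : IsWQO Q)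
    (hprin : Ordinal.Principal (· * ·) (mot Q)) (hh : height Q < mot Q) :
    width Q = mot Q := by
  have hwf : WellFounded (extRel (BadSeqs Q)) :=
    Stmt12.wf_of_ne_zero (ne_of_gt (lt_of_le_of_lt zero_le hh) : mot Q ≠ 0)
  refine le_antisymm (Stmt12.treeRank_mono hwf Stmt12.inc_subset) ?_
  by_contra hlt
  have hw : width Q < mot Q := not_le.1 hlt
  suffices ∃ d < mot Q, Stmt12.Bd (Stmt12.rect (height Q) (width Q)) d by
    obtain ⟨d, hd, hb⟩ := this
    exact absurd (Stmt12.mot_le hwf hb) (not_le.2 hd)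
  rcases isPrincipal_mul_iff_le_two_or_omega0_opow_opow.1 hprin with h2 | ⟨r, hr⟩
  · have h1 : ∀ a : Ordinal.{u}, a < mot Q → a ≤ 1 := fun a ha => by
      rw [← Order.lt_succ_iff, Ordinal.succ_one]
      exact ha.trans_le h2
    by_cases h0 : height Q = 0
    · refine ⟨0, lt_of_le_of_lt zero_le hh, Stmt12.Bd.of_exists fun x hx => ?_⟩
      have := hx.1
      simp [h0] at this
    · have e : height Q = 1 :=
        le_antisymm (h1 _ hh) (Order.one_le_iff_pos.2 (pos_iff_ne_zero.2 h0))
      refine ⟨1, e ▸ hh, ?_⟩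
      have hb := Stmt12.bd_opow (0 : Ordinal.{u}) 0
      have hn : Stmt12.nsum (0 : Ordinal.{u}) 0 = 0 := by
        have := Stmt12.nsum_lt_opow (0 : Ordinal.{u}) 0 (by simp) 0 (by simp)
        simpa using this
      rw [hn, opow_zero] at hb
      exact hb.mono_left (Stmt12.rect_mono (h1 _ hh) (h1 _ hw))
  · have hr : ω ^ ω ^ r = mot Q := hr
    rw [← hr] at hh hw ⊢
    exact Stmt12.bd_of_lt hh hw
end

section
/- For every ordinal α there exists a well partial order P_α with w(P_α) = α. -/
universe u

open Ordinal

/-- Incomparability. -/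
def Inc {P : Type u} [Preorder P] (x y : P) : Prop := ¬ x ≤ y ∧ ¬ y ≤ x

/-- `f` computes the rank of every (possibly empty) antichain sequence. -/
def IsRk {P : Type u} [Preorder P] (f : List P → Ordinal.{u}) : Prop :=
  ∀ s : List P, s.Pairwise Inc →
    (∀ x, (s ++ [x]).Pairwise Inc → f (s ++ [x]) < f s) ∧
    (∀ δ < f s, ∃ x, (s ++ [x]).Pairwise Inc ∧ δ ≤ f (s ++ [x]))

theorem IsRk.ext_le {P : Type u} [Preorder P] {f : List P → Ordinal.{u}} (hf : IsRk f)
    (s t : List P) (h : (s ++ t).Pairwise Inc) : f (s ++ t) ≤ f s := by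
  induction t generalizing s with
  | nil => simp
  | cons a t ih =>
    have e : s ++ a :: t = (s ++ [a]) ++ t := by simp
    rw [e] at h ⊢
    have h1 : (s ++ [a]).Pairwise Inc := (List.pairwise_append.1 h).1
    have h2 : s.Pairwise Inc := (List.pairwise_append.1 h1).1
    exact (ih _ h).trans ((hf s h2).1 a h1).le

theorem IsRk.ext_lt {P : Type u} [Preorder P] {f : List P → Ordinal.{u}} (hf : IsRk f)
    (s t : List P) (ht : t ≠ []) (h : (s ++ t).Pairwise Inc) : f (s ++ t) < f s := by
  cases t with
  | nil => exact absurd rfl ht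
  | cons a t =>
    have e : s ++ a :: t = (s ++ [a]) ++ t := by simp
    rw [e] at h ⊢
    have h1 : (s ++ [a]).Pairwise Inc := (List.pairwise_append.1 h).1
    have h2 : s.Pairwise Inc := (List.pairwise_append.1 h1).1
    exact (hf.ext_le _ _ h).trans_lt ((hf s h2).1 a h1)

theorem IsRk.extRel_lt {P : Type u} [Preorder P] {f : List P → Ordinal.{u}} (hf : IsRk f)
    (s t : IncSeqs P) (h : extRel (IncSeqs P) s t) : f s.1 < f t.1 := by
  obtain ⟨⟨r, hr⟩, hne⟩ := h
  have hs := s.2.2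
  rw [← hr] at hs ⊢
  refine hf.ext_lt _ _ ?_ hs
  rintro rfl
  exact hne (by simpa using hr)

theorem IsRk.wf {P : Type u} [Preorder P] {f : List P → Ordinal.{u}} (hf : IsRk f) :
    WellFounded (extRel (IncSeqs P)) :=
  Subrelation.wf (fun {s t} h => hf.extRel_lt s t h)
    (InvImage.wf (fun s : IncSeqs P => f s.1) Ordinal.lt_wf)

theorem IsRk.rank_eq {P : Type u} [Preorder P] {f : List P → Ordinal.{u}} (hf : IsRk f)
    (s : IncSeqs P) : (hf.wf.apply s).rank = f s.1 := by
  induction s using hf.wf.induction with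
  | _ s ih =>
  apply le_antisymm
  · rw [Acc.rank_eq]
    apply Ordinal.iSup_le
    rintro ⟨t, ht⟩
    rw [Order.succ_le_iff, ih t ht]
    exact hf.extRel_lt t s ht
  · by_contra! hlt
    obtain ⟨x, hx, hle⟩ := (hf s.1 s.2.2).2 _ hlt
    have hr : extRel (IncSeqs P) ⟨s.1 ++ [x], by simp, hx⟩ s :=
      ⟨⟨[x], rfl⟩, by simp⟩
    have h1 := Acc.rank_lt_of_rel (hf.wf.apply s) hr
    have h2 := ih _ hr
    rw [← h2] at hle
    exact absurd h1 (not_lt.2 hle)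

theorem IsRk.width_eq {P : Type u} [Preorder P] {f : List P → Ordinal.{u}} (hf : IsRk f) :
    width P = f [] := by
  unfold width treeRank relRank
  rw [dif_pos hf.wf]
  apply le_antisymm
  · apply Ordinal.iSup_le
    intro s
    rw [Order.succ_le_iff, hf.rank_eq]
    exact hf.ext_lt [] s.1 s.2.1 s.2.2
  · by_contra! hlt
    obtain ⟨x, hx, hle⟩ := (hf [] List.Pairwise.nil).2 _ hlt
    have h1 := Ordinal.le_iSup
      (fun a : IncSeqs P => Order.succ ((hf.wf.apply a).rank)) ⟨[] ++ [x], by simp, hx⟩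
    rw [hf.rank_eq, Order.succ_le_iff] at h1
    exact absurd h1 (not_lt.2 hle)

theorem IsRk.fac {P : Type u} [Preorder P] {f : List P → Ordinal.{u}} (hf : IsRk f) :
    FAC P := by
  intro A hA
  by_contra hinf
  have key : ∀ γ : Ordinal.{u}, ∀ s : List P, f s = γ → s.Pairwise Inc →
      (∀ x ∈ s, x ∈ A) → False := by
    intro γ
    induction γ using Ordinal.lt_wf.induction with
    | _ γ ih =>
    intro s hs hp hsA
    obtain ⟨x, hxA, hxs⟩ := Set.Infinite.exists_notMem_finset hinf (by classical exact s.toFinset)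
    have hxs : x ∉ s := by simpa using hxs
    have hp2 : (s ++ [x]).Pairwise Inc := by
      rw [List.pairwise_append]
      refine ⟨hp, by simp, fun a ha b hb => ?_⟩
      rw [List.mem_singleton] at hb
      subst hb
      have hne : a ≠ b := fun h => hxs (h ▸ ha)
      exact ⟨hA (hsA a ha) hxA hne, hA hxA (hsA a ha) hne.symm⟩
    refine ih _ (hs ▸ (hf s hp).1 x hp2) (s ++ [x]) rfl hp2 ?_
    intro y hy
    rcases List.mem_append.1 hy with h | h
    · exact hsA y h
    · rw [List.mem_singleton.1 h]; exact hxA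
  exact key _ [] rfl List.Pairwise.nil (by simp)

/-- left parts of a list -/
def lefts {P : Type u} (s : List (P ⊕ PUnit.{u+1})) : List P := s.filterMap Sum.getLeft?

open Classical in
/-- The rank function for a disjoint sum with a point. -/
noncomputable def sumRk {P : Type u} (f : List P → Ordinal.{u})
    (s : List (P ⊕ PUnit.{u+1})) : Ordinal.{u} :=
  if Sum.inr PUnit.unit ∈ s then f (lefts s) else Order.succ (f (lefts s))

theorem inc_inl {P : Type u} [PartialOrder P] (x y : P) :
    Inc (Sum.inl x : P ⊕ PUnit.{u+1}) (Sum.inl y) ↔ Inc x y := by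
  simp [Inc]

theorem lefts_pairwise {P : Type u} [PartialOrder P] (s : List (P ⊕ PUnit.{u+1}))
    (h : s.Pairwise Inc) : (lefts s).Pairwise Inc := by
  unfold lefts
  rw [List.pairwise_filterMap]
  refine h.imp ?_
  rintro (a | a) (b | b) hab x hx y hy <;> simp at hx hy
  subst hx hy
  exact (inc_inl _ _).1 hab

theorem mem_lefts {P : Type u} (s : List (P ⊕ PUnit.{u+1})) (x : P) :
    x ∈ lefts s ↔ Sum.inl x ∈ s := by
  simp [lefts]

theorem IsRk.sum {P : Type u} [PartialOrder P] {f : List P → Ordinal.{u}} (hf : IsRk f) :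
    IsRk (sumRk f) := by
  intro s hs
  have hl := lefts_pairwise s hs
  have e1 : ∀ x, lefts (s ++ [Sum.inl x]) = lefts s ++ [x] := by simp [lefts]
  have e2 : ∀ x, lefts (s ++ [Sum.inr x]) = lefts s := by simp [lefts]
  constructor
  · rintro (x | x) hx
    · have := (hf _ hl).1 x (e1 x ▸ lefts_pairwise _ hx)
      unfold sumRk
      rw [e1]
      by_cases hm : Sum.inr PUnit.unit ∈ s
      · simpa [hm] using this
      · simpa [hm] using this
    · have hns : Sum.inr PUnit.unit ∉ s := by
        intro hm
        have := (List.pairwise_append.1 hx).2.2 _ hm (Sum.inr x) (by simp)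
        exact this.1 le_rfl
      unfold sumRk
      rw [e2]
      simp [hns]
  · intro δ hδ
    unfold sumRk at hδ
    by_cases hm : Sum.inr PUnit.unit ∈ s
    · rw [if_pos hm] at hδ
      obtain ⟨x, hx, hle⟩ := (hf _ hl).2 δ hδ
      refine ⟨Sum.inl x, ?_, ?_⟩
      · rw [List.pairwise_append]
        refine ⟨hs, by simp, ?_⟩
        rintro (a | a) ha b hb
        · rw [List.mem_singleton.1 hb, inc_inl]
          exact (List.pairwise_append.1 hx).2.2 a ((mem_lefts _ _).2 ha) x (by simp)
        · rw [List.mem_singleton.1 hb]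
          simp [Inc]
      · unfold sumRk
        rw [e1]
        simpa [hm] using hle
    · rw [if_neg hm, Order.lt_succ_iff] at hδ
      refine ⟨Sum.inr PUnit.unit, ?_, ?_⟩
      · rw [List.pairwise_append]
        refine ⟨hs, by simp, ?_⟩
        rintro (a | a) ha b hb
        · rw [List.mem_singleton.1 hb]
          simp [Inc]
        · exact absurd ha hm
      · unfold sumRk
        rw [e2]
        simpa using hδ

theorem sum_wf {P : Type u} [PartialOrder P] (h : WellFounded ((· < ·) : P → P → Prop)) :
    WellFounded ((· < ·) : P ⊕ PUnit.{u+1} → P ⊕ PUnit.{u+1} → Prop) := by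
  constructor
  rintro (x | x)
  · induction x using h.induction with
    | _ x ih =>
    constructor
    rintro (y | y) hy
    · exact ih y (by simpa using hy)
    · simp at hy
  · constructor
    rintro (y | y) hy
    · simp at hy
    · simp at hy

section sigma

variable {I : Type u} [LinearOrder I] {Q : I → Type u} [∀ i, PartialOrder (Q i)]

/-- Carrier of the lexicographic sum. -/
structure Lx {I : Type u} (Q : I → Type u) : Type u where
  fst : I
  snd : Q fst

noncomputable instance : PartialOrder (Lx Q) :=
  PartialOrder.lift (fun p => (toLex ⟨p.1, p.2⟩ : Σₗ i, Q i)) (by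
    rintro ⟨i, x⟩ ⟨j, y⟩ h
    have h' : (⟨i, x⟩ : Sigma Q) = ⟨j, y⟩ := h
    cases h'
    rfl)

theorem Lx.le_iff (a b : Lx Q) : a ≤ b ↔ a.1 < b.1 ∨ ∃ h : a.1 = b.1, h.rec a.2 ≤ b.2 :=
  Sigma.lex_iff

theorem Lx.lt_iff (a b : Lx Q) : a < b ↔ a.1 < b.1 ∨ ∃ h : a.1 = b.1, h.rec a.2 < b.2 :=
  Sigma.lex_iff

theorem sigma_wf (hI : WellFounded ((· < ·) : I → I → Prop))
    (h : ∀ i, WellFounded ((· < ·) : Q i → Q i → Prop)) :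
    WellFounded ((· < ·) : (Lx Q) → (Lx Q) → Prop) := by
  constructor
  rintro ⟨i, x⟩
  induction i using hI.induction with
  | _ i ihi =>
  induction x using (h i).induction with
  | _ x ih =>
  constructor
  rintro ⟨j, y⟩ hy
  rcases (Lx.lt_iff _ _).1 hy with hij | ⟨hij, hab⟩
  · exact ihi _ hij y
  · have hij' : j = i := hij
    subst hij'
    exact ih _ hab

open Classical in
/-- elements of the fibre over `i` -/
noncomputable def fib (i : I) (s : List (Lx Q)) : List (Q i) :=
  s.filterMap fun p => if h : p.1 = i then some (h ▸ p.2) else none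

theorem fib_map (i : I) (l : List (Q i)) :
    fib i (l.map fun x => (⟨i, x⟩ : Lx Q)) = l := by
  simp [fib, List.filterMap_map, Function.comp_def]

/-- The rank function of a lexicographic sum. -/
noncomputable def sigRk (F : ∀ i, List (Q i) → Ordinal.{u}) (α : Ordinal.{u}) :
    List (Lx Q) → Ordinal.{u}
  | [] => α
  | p :: s => F p.1 (fib p.1 (p :: s))

theorem sigRk_map (F : ∀ i, List (Q i) → Ordinal.{u}) (α : Ordinal.{u}) (i : I) (l : List (Q i))
    (hl : l ≠ []) : sigRk F α (l.map fun x => (⟨i, x⟩ : Lx Q)) = F i l := by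
  cases l with
  | nil => exact absurd rfl hl
  | cons a l =>
    have := fib_map i (a :: l)
    rw [List.map_cons] at this ⊢
    rw [sigRk, this]

theorem inc_mk (i : I) (x y : Q i) :
    Inc (⟨i, x⟩ : Lx Q) ⟨i, y⟩ ↔ Inc x y := by
  simp [Inc, Lx.le_iff]

theorem inc_fst (p q : Lx Q) (h : Inc p q) : p.1 = q.1 := by
  by_contra hne
  rcases lt_or_gt_of_ne hne with h1 | h1
  · exact h.1 ((Lx.le_iff _ _).2 (Or.inl h1))
  · exact h.2 ((Lx.le_iff _ _).2 (Or.inl h1))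

theorem pairwise_map_mk (i : I) (l : List (Q i)) :
    (l.map fun x => (⟨i, x⟩ : Lx Q)).Pairwise Inc ↔ l.Pairwise Inc := by
  rw [List.pairwise_map]
  simp only [inc_mk]

theorem exists_map (i : I) (s : List (Lx Q)) (h : ∀ p ∈ s, p.1 = i) :
    ∃ l : List (Q i), s = l.map fun x => (⟨i, x⟩ : Lx Q) := by
  induction s with
  | nil => exact ⟨[], rfl⟩
  | cons p s ih =>
    obtain ⟨l, rfl⟩ := ih fun q hq => h q (List.mem_cons_of_mem _ hq)
    obtain ⟨j, x⟩ := p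
    have hj : j = i := h _ List.mem_cons_self
    subst hj
    exact ⟨x :: l, rfl⟩

theorem sig_isRk (F : ∀ i, List (Q i) → Ordinal.{u}) (hF : ∀ i, IsRk (F i)) (α : Ordinal.{u})
    (h1 : ∀ i, F i [] ≤ α) (h2 : ∀ δ < α, ∃ i, δ < F i []) : IsRk (sigRk F α) := by
  have single : ∀ i (x : Q i), sigRk F α [(⟨i, x⟩ : Lx Q)] = F i [x] := fun i x =>
    sigRk_map F α i [x] (by simp)
  intro s hs
  cases s with
  | nil =>
    constructor
    · rintro ⟨i, x⟩ -
      rw [List.nil_append, single]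
      exact ((hF i [] List.Pairwise.nil).1 x (by simp)).trans_le (h1 i)
    · intro δ hδ
      obtain ⟨i, hi⟩ := h2 δ hδ
      obtain ⟨x, -, hle⟩ := (hF i [] List.Pairwise.nil).2 δ hi
      refine ⟨⟨i, x⟩, by simp, ?_⟩
      rw [List.nil_append, single]
      exact hle
  | cons p s =>
    obtain ⟨l, hl⟩ : ∃ l : List (Q p.1), p :: s = l.map fun x => (⟨p.1, x⟩ : Lx Q) := by
      apply exists_map
      intro q hq
      rcases List.mem_cons.1 hq with rfl | hq
      · rfl
      · exact (inc_fst _ _ ((List.pairwise_cons.1 hs).1 q hq)).symm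
    have hne : l ≠ [] := by
      rintro rfl
      simp at hl
    have happ : ∀ x : Q p.1, (l.map fun x => (⟨p.1, x⟩ : Lx Q)) ++ [⟨p.1, x⟩] =
        (l ++ [x]).map fun x => (⟨p.1, x⟩ : Lx Q) := by simp
    have hlp : l.Pairwise Inc := by rwa [hl, pairwise_map_mk] at hs
    constructor
    · intro q hq
      have hpq : p.1 = q.1 := inc_fst _ _ ((List.pairwise_append.1 hq).2.2 p (by simp) q (by simp))
      obtain ⟨l2, hl2⟩ := exists_map p.1 [q] (by simp [hpq])
      obtain ⟨x, rfl⟩ : ∃ x : Q p.1, q = ⟨p.1, x⟩ := by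
        cases l2 with
        | nil => simp at hl2
        | cons x l2 => exact ⟨x, (List.cons.inj hl2).1⟩
      rw [hl, happ] at hq ⊢
      rw [sigRk_map _ _ _ _ hne, sigRk_map _ _ _ _ (by simp)]
      exact (hF _ l hlp).1 x ((pairwise_map_mk _ _).1 hq)
    · intro δ hδ
      rw [hl, sigRk_map _ _ _ _ hne] at hδ
      obtain ⟨x, hx, hle⟩ := (hF _ l hlp).2 δ hδ
      refine ⟨⟨p.1, x⟩, ?_⟩
      rw [hl, happ, sigRk_map _ _ _ _ (by simp), pairwise_map_mk]
      exact ⟨hx, hle⟩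

end sigma

theorem exists_rk (α : Ordinal.{u}) :
    ∃ (P : Type u) (_ : PartialOrder P) (f : List P → Ordinal.{u}),
      WellFounded ((· < ·) : P → P → Prop) ∧ IsRk f ∧ f [] = α := by
  induction α using Ordinal.lt_wf.induction with
  | _ α ih =>
  have ih' : ∀ i : α.ToType, ∃ (P : Type u) (_ : PartialOrder P) (f : List P → Ordinal.{u}),
      WellFounded ((· < ·) : P → P → Prop) ∧ IsRk f ∧ f [] = (Ordinal.ToType.toOrd i).1 :=
    fun i => ih _ (Ordinal.ToType.toOrd i).2
  choose P inst f hwf hrk hnil using ih'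
  have e : ∀ i, sumRk (f i) [] = Order.succ (Ordinal.ToType.toOrd i).1 := by
    intro i
    simp [sumRk, lefts, hnil]
  refine ⟨Lx fun i => P i ⊕ PUnit.{u+1}, inferInstance, sigRk (fun i => sumRk (f i)) α,
    sigma_wf wellFounded_lt fun i => sum_wf (hwf i), sig_isRk _ (fun i => (hrk i).sum) α ?_ ?_, rfl⟩
  · intro i
    rw [e, Order.succ_le_iff]
    exact (Ordinal.ToType.toOrd i).2
  · intro δ hδ
    refine ⟨Ordinal.ToType.mk ⟨δ, hδ⟩, ?_⟩
    rw [e]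
    simp

/-- Every ordinal is the width of some well partial order. -/
theorem stmt_15 (α : Ordinal.{u}) :
    ∃ (P : Type u) (inst : PartialOrder P),
      @IsWPO P inst.toPreorder ∧ @width P inst.toPreorder = α := by
  obtain ⟨P, inst, f, hwf, hrk, hnil⟩ := exists_rk α
  exact ⟨P, inst, ⟨hwf, hrk.fac⟩, hrk.width_eq.trans hnil⟩
end
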